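/- arXiv:2510.09899 — 13 statements merged into one kernel-verified Lean document; each statement's English description precedes it below -/
import Mathlib

section
/- The function f(q) = q·λ·𝔼[R − C·W_G(qΛ)] is strictly concave on the interval [0, μ/λ_max). -/
open MeasureTheory

/-- The M/G/1 expected waiting time at effective arrival rate `x`. -/
noncomputable def WG (μ s x : ℝ) : ℝ := 1 / μ + s ^ 2 * x / (2 * (1 - x / μ))

/-- An integral of almost everywhere strictly concave functions is strictly concave. -/
theorem StrictConcaveOn.integral_of_ae {Ω : Type*} [MeasurableSpace Ω] {ν : Measure Ω} [NeZero ν]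
    {S : Set ℝ} (hS : Convex ℝ S) {F : ℝ → Ω → ℝ} (hF : ∀ q ∈ S, Integrable (F q) ν)
    (hconc : ∀ᵐ ω ∂ν, StrictConcaveOn ℝ S (fun q => F q ω)) :
    StrictConcaveOn ℝ S (fun q => ∫ ω, F q ω ∂ν) := by
  refine ⟨hS, fun x hx y hy hxy a b ha hb hab => ?_⟩
  have hz : a • x + b • y ∈ S := hS hx hy ha.le hb.le hab
  have hxi := (hF x hx).const_mul a
  have hyi := (hF y hy).const_mul b
  have hsum : Integrable (fun ω => a * F x ω + b * F y ω) ν := hxi.add hyi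
  have hlt : ∀ᵐ ω ∂ν, a * F x ω + b * F y ω < F (a • x + b • y) ω := by
    filter_upwards [hconc] with ω hω
    exact hω.2 hx hy hxy ha hb hab
  have hpos : 0 < ∫ ω, (F (a • x + b • y) ω - (a * F x ω + b * F y ω)) ∂ν := by
    refine (integral_pos_iff_support_of_nonneg_ae ?_ ((hF _ hz).sub hsum)).2 ?_
    · filter_upwards [hlt] with ω hω
      exact (sub_pos.2 hω).le
    · refine pos_iff_ne_zero.2 fun h0 => ?_
      have hae := measure_eq_zero_iff_ae_notMem.1 h0
      obtain ⟨ω, hω, hω'⟩ := (hlt.and hae).exists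
      exact hω' (sub_pos.2 hω).ne'
  rw [integral_sub (hF _ hz) hsum, integral_add hxi hyi, integral_const_mul,
    integral_const_mul] at hpos
  simpa only [smul_eq_mul, sub_pos] using hpos

/-- The map `q ↦ q ^ 2 / (1 - q * t)` is strictly convex where its denominator is positive. -/
theorem strictConvexOn_sq_div_one_sub_mul {S : Set ℝ} (hS : Convex ℝ S) {t : ℝ}
    (ht : ∀ q ∈ S, q * t < 1) : StrictConvexOn ℝ S (fun q => q ^ 2 / (1 - q * t)) := by
  refine ⟨hS, fun x hx y hy hxy a b ha hb hab => ?_⟩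
  have hz := sub_pos.2 (ht _ (hS hx hy ha.le hb.le hab))
  have hx' := sub_pos.2 (ht x hx)
  have hy' := sub_pos.2 (ht y hy)
  simp only [smul_eq_mul] at hz ⊢
  have hgap : a * (x ^ 2 / (1 - x * t)) + b * (y ^ 2 / (1 - y * t))
      - (a * x + b * y) ^ 2 / (1 - (a * x + b * y) * t)
      = a * b * (x - y) ^ 2 / ((1 - x * t) * (1 - y * t) * (1 - (a * x + b * y) * t)) := by
    obtain rfl : b = 1 - a := by linarith
    rw [← mul_div_assoc, ← mul_div_assoc, div_add_div _ _ hx'.ne' hy'.ne',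
      div_sub_div _ _ (mul_pos hx' hy').ne' hz.ne']
    congr 1
    ring
  have hsq : 0 < (x - y) ^ 2 := by
    have := sub_ne_zero.2 hxy
    positivity
  rw [← sub_pos, hgap]
  positivity

/-- For a deterministic arrival rate the expected net benefit is strictly concave. -/
theorem strictConcaveOn_mul_sub_WG {S : Set ℝ} (hS : Convex ℝ S) {μ lam C s L : ℝ} (R : ℝ)
    (hμ : 0 < μ) (hlam : 0 < lam) (hC : 0 < C) (hs : 0 < s) (hL : 0 < L)
    (hlt : ∀ q ∈ S, q * L < μ) :
    StrictConcaveOn ℝ S (fun q => q * lam * (R - C * WG μ s (q * L))) := by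
  have hconv := strictConvexOn_sq_div_one_sub_mul (t := L / μ) hS fun q hq => by
    rw [← mul_div_assoc, div_lt_one hμ]
    exact hlt q hq
  refine ⟨hS, fun x hx y hy hxy a b ha hb hab => ?_⟩
  have hsplit (q : ℝ) : q * lam * (R - C * WG μ s (q * L))
      = q * (lam * (R - C / μ)) - lam * C * s ^ 2 * L / 2 * (q ^ 2 / (1 - q * (L / μ))) := by
    rw [WG, ← mul_div_assoc, mul_comm 2, ← div_div]
    ring
  have hk : 0 < lam * C * s ^ 2 * L / 2 := by positivity
  have h := mul_lt_mul_of_pos_left (hconv.2 hx hy hxy ha hb hab) hk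
  simp only [hsplit, smul_eq_mul] at h ⊢
  linarith

theorem integrable_WG {Ω : Type*} [MeasurableSpace Ω] {ν : Measure Ω} [IsFiniteMeasure ν]
    {μ q M : ℝ} (s : ℝ) (hμ : 0 < μ) (hq : 0 ≤ q) (hqM : q * M < μ) {Λ : Ω → ℝ}
    (hΛ : Measurable Λ) (hbdd : ∀ᵐ ω ∂ν, 0 ≤ Λ ω ∧ Λ ω ≤ M) :
    Integrable (fun ω => WG μ s (q * Λ ω)) ν := by
  have hmeas : Measurable (fun ω => WG μ s (q * Λ ω)) := by
    unfold WG
    fun_prop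
  refine Integrable.of_bound hmeas.aestronglyMeasurable (WG μ s (q * M)) ?_
  filter_upwards [hbdd] with ω ⟨h0, hM⟩
  have hle : q * Λ ω ≤ q * M := mul_le_mul_of_nonneg_left hM hq
  have hden : 0 < 1 - q * M / μ := sub_pos.2 ((div_lt_one hμ).2 hqM)
  have hden' : 1 - q * M / μ ≤ 1 - q * Λ ω / μ := by gcongr
  have hden0 : 0 < 1 - q * Λ ω / μ := hden.trans_le hden'
  have hnonneg : 0 ≤ WG μ s (q * Λ ω) := by
    unfold WG
    positivity
  rw [Real.norm_of_nonneg hnonneg]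
  unfold WG
  have hM0 : 0 ≤ M := h0.trans hM
  gcongr

/-- The function `f(q) = q·λ·𝔼[R − C·W_G(qΛ)]` is strictly concave on `[0, μ/λ_max)`. -/
theorem stmt0
    {Ω : Type*} [MeasureSpace Ω] [IsProbabilityMeasure (volume : Measure Ω)]
    (μ lam R C s lamMin lamMax : ℝ)
    (hμ : 0 < μ) (hlam : 0 < lam) (hC : 0 < C) (hs : 0 < s)
    (hMin : 0 < lamMin) (hMinMax : lamMin ≤ lamMax)
    (Λ : Ω → ℝ) (hΛ : Measurable Λ)
    (hbdd : ∀ᵐ ω, lamMin ≤ Λ ω ∧ Λ ω ≤ lamMax) :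
    StrictConcaveOn ℝ (Set.Ico (0 : ℝ) (μ / lamMax))
      (fun q => q * lam * ∫ ω, (R - C * WG μ s (q * Λ ω))) := by
  have hMax : 0 < lamMax := hMin.trans_le hMinMax
  have hlt : ∀ q ∈ Set.Ico (0 : ℝ) (μ / lamMax), q * lamMax < μ := fun q hq =>
    (lt_div_iff₀ hMax).1 hq.2
  simp only [← integral_const_mul]
  refine StrictConcaveOn.integral_of_ae (convex_Ico _ _) (fun q hq => ?_) ?_
  · have hW := integrable_WG s hμ hq.1 (hlt q hq) hΛ
      (hbdd.mono fun ω h => ⟨hMin.le.trans h.1, h.2⟩)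
    exact ((integrable_const R).sub (hW.const_mul C)).const_mul _
  · filter_upwards [hbdd] with ω ⟨h1, h2⟩
    exact strictConcaveOn_mul_sub_WG (convex_Ico _ _) R hμ hlam hC hs (hMin.trans_le h1)
      fun q hq => (mul_le_mul_of_nonneg_left h2 hq.1).trans_lt (hlt q hq)
end

section
/- The function g(q) = q·λ·(R − C·W_G(qλ)) is strictly concave on the interval [0, μ/λ). -/
theorem inv_convexCombo_lt {u v a b : ℝ} (hu : 0 < u) (hv : 0 < v) (huv : u ≠ v)
    (ha : 0 < a) (hb : 0 < b) (hab : a + b = 1) :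
    (a * u + b * v)⁻¹ < a * u⁻¹ + b * v⁻¹ := by
  have h := (strictConvexOn_zpow (m := -1) (by norm_num) (by norm_num)).2
    (Set.mem_Ioi.2 hu) (Set.mem_Ioi.2 hv) huv ha hb hab
  simpa using h

/-- Partial fraction decomposition of the objective in the residual capacity `μ - q * lam`. -/
theorem mul_sub_WG_eq {μ lam q : ℝ} (R C s : ℝ) (hμ : μ ≠ 0) (hq : μ - q * lam ≠ 0) :
    q * lam * (R - C * WG μ s (q * lam)) =
      C * s ^ 2 * μ ^ 2 / 2 + q * lam * (R - C / μ + C * s ^ 2 * μ / 2)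
        - C * s ^ 2 * μ ^ 3 / 2 * (μ - q * lam)⁻¹ := by
  have h : 1 - q * lam / μ = (μ - q * lam) / μ := by field_simp
  rw [WG, h]
  field_simp
  ring

/-- The function `g(q) = q·λ·(R − C·W_G(qλ))` is strictly concave on `[0, μ/λ)`. -/
theorem stmt2
    (μ lam R C s : ℝ)
    (hμ : 0 < μ) (hlam : 0 < lam) (hC : 0 < C) (hs : 0 < s) :
    StrictConcaveOn ℝ (Set.Ico (0 : ℝ) (μ / lam))
      (fun q => q * lam * (R - C * WG μ s (q * lam))) := by
  refine ⟨convex_Ico _ _, fun x hx y hy hxy a b ha hb hab => ?_⟩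
  have hpos : ∀ q ∈ Set.Ico (0 : ℝ) (μ / lam), 0 < μ - q * lam := fun q hq =>
    sub_pos.2 ((lt_div_iff₀ hlam).1 hq.2)
  have hz := hpos _ (convex_Ico _ _ hx hy ha.le hb.le hab)
  have hne : μ - x * lam ≠ μ - y * lam := fun h =>
    hxy (mul_right_cancel₀ hlam.ne' (sub_right_injective h))
  have hinv := inv_convexCombo_lt (hpos x hx) (hpos y hy) hne ha hb hab
  have hcombo : a * (μ - x * lam) + b * (μ - y * lam) = μ - (a * x + b * y) * lam := by
    linear_combination μ * hab
  rw [hcombo] at hinv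
  have hK : 0 < C * s ^ 2 * μ ^ 3 / 2 := by positivity
  have hgap := mul_lt_mul_of_pos_left hinv hK
  simp only [smul_eq_mul] at hz ⊢
  rw [mul_sub_WG_eq R C s hμ.ne' (hpos x hx).ne', mul_sub_WG_eq R C s hμ.ne' (hpos y hy).ne',
    mul_sub_WG_eq R C s hμ.ne' hz.ne']
  obtain rfl : b = 1 - a := by linarith
  linarith
end

section
/- Suppose q̃_e ∈ (0, μ/λ_max) satisfies 𝔼[R − C/(μ − q̃_e·Λ)] = 0, and suppose q_m ∈ [0, 1] satisfies Rev^S(q_m) ≥ Rev^S(q) for all q ∈ [0, 1]. Then q_m ≤ min{q̃_e, 1}. (The revenue maximizer's equilibrium joining probability is at most the individual equilibrium joining probability: q^S_m ≤ q^S_e.) -/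
open MeasureTheory

/-- The surplus integrand is integrable when the load `q Λ` stays bounded away
from the service rate. -/
theorem integrable_surplus {Ω : Type*} [MeasurableSpace Ω] {P : Measure Ω} [IsFiniteMeasure P]
    {μ R C a b q : ℝ} (hC : 0 ≤ C) (hq : 0 ≤ q) (hqb : q * b < μ)
    {Λ : Ω → ℝ} (hΛ : Measurable Λ) (hbdd : ∀ᵐ ω ∂P, a ≤ Λ ω ∧ Λ ω ≤ b) :
    Integrable (fun ω => R - C / (μ - q * Λ ω)) P := by
  refine Integrable.of_mem_Icc (R - C / (μ - q * b)) R (by fun_prop) ?_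
  filter_upwards [hbdd] with ω ⟨h₁, h₂⟩
  have hle : q * Λ ω ≤ q * b := mul_le_mul_of_nonneg_left h₂ hq
  constructor
  · have : C / (μ - q * Λ ω) ≤ C / (μ - q * b) :=
      div_le_div_of_nonneg_left hC (by linarith) (by linarith)
    linarith
  · have : 0 ≤ C / (μ - q * Λ ω) := div_nonneg hC (by linarith)
    linarith

/-- The expected surplus is strictly decreasing in the joining probability. -/
theorem integral_surplus_lt {Ω : Type*} [MeasurableSpace Ω] {P : Measure Ω}
    [IsProbabilityMeasure P] {μ R C a b q q' : ℝ} (hC : 0 < C) (ha : 0 < a)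
    (hq : 0 ≤ q) (hqq' : q < q') (hq'b : q' * b < μ)
    {Λ : Ω → ℝ} (hΛ : Measurable Λ) (hbdd : ∀ᵐ ω ∂P, a ≤ Λ ω ∧ Λ ω ≤ b) :
    ∫ ω, (R - C / (μ - q' * Λ ω)) ∂P < ∫ ω, (R - C / (μ - q * Λ ω)) ∂P := by
  obtain ⟨ω₀, h₀, h₀'⟩ := hbdd.exists
  have hb : 0 < b := by linarith
  have hqb : q * b < μ := (mul_le_mul_of_nonneg_right hqq'.le hb.le).trans_lt hq'b
  have hi := integrable_surplus (R := R) hC.le hq hqb hΛ hbdd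
  have hi' := integrable_surplus (R := R) hC.le (hq.trans hqq'.le) hq'b hΛ hbdd
  have hlt : ∀ᵐ ω ∂P, R - C / (μ - q' * Λ ω) < R - C / (μ - q * Λ ω) := by
    filter_upwards [hbdd] with ω ⟨h₁, h₂⟩
    have hpos : q' * Λ ω ≤ q' * b := mul_le_mul_of_nonneg_left h₂ (hq.trans hqq'.le)
    have hstrict : q * Λ ω < q' * Λ ω := mul_lt_mul_of_pos_right hqq' (by linarith)
    have : C / (μ - q * Λ ω) < C / (μ - q' * Λ ω) :=
      div_lt_div_of_pos_left hC (by linarith) (by linarith)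
    linarith
  refine (integral_mono_ae hi' hi (hlt.mono fun _ h => h.le)).lt_of_ne fun heq => ?_
  have hae := (integral_eq_iff_of_ae_le hi' hi (hlt.mono fun _ h => h.le)).1 heq
  obtain ⟨ω, h₁, h₂⟩ := (hlt.and hae).exists
  exact h₁.ne h₂

/-- In the M/M/1 shared-belief model, if `q̃_e ∈ (0, μ/λ_max)` solves
`𝔼[R − C/(μ − q̃_e Λ)] = 0` and `q_m ∈ [0,1]` maximizes the shared-belief revenue
`Rev^S(q) = qλ𝔼[R − C/(μ − qΛ)]` over `[0,1]`, then `q_m ≤ min{q̃_e, 1}`. -/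
theorem stmt4
    {Ω : Type*} [MeasureSpace Ω] [IsProbabilityMeasure (volume : Measure Ω)]
    (μ lam R C lamMin lamMax : ℝ)
    (hlam : 0 < lam) (hlamμ : lam < μ) (hC : 0 < C) (hR : C / μ ≤ R)
    (hMin : 0 < lamMin) (hMinMax : lamMin ≤ lamMax) (hMaxμ : lamMax < μ)
    (Λ : Ω → ℝ) (hΛ : Measurable Λ)
    (hbdd : ∀ᵐ ω, lamMin ≤ Λ ω ∧ Λ ω ≤ lamMax)
    (qe : ℝ) (hqe : qe ∈ Set.Ioo (0 : ℝ) (μ / lamMax))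
    (hqe_eq : (∫ ω, (R - C / (μ - qe * Λ ω))) = 0)
    (qm : ℝ) (hqm : qm ∈ Set.Icc (0 : ℝ) 1)
    (hqm_max : ∀ q ∈ Set.Icc (0 : ℝ) 1,
      q * lam * ∫ ω, (R - C / (μ - q * Λ ω)) ≤ qm * lam * ∫ ω, (R - C / (μ - qm * Λ ω))) :
    qm ≤ min qe 1 := by
  refine le_min (le_of_not_gt fun hlt => ?_) hqm.2
  have hMax : 0 < lamMax := hMin.trans_le hMinMax
  have hload : qm * lamMax < μ :=
    (mul_le_of_le_one_left hMax.le hqm.2).trans_lt hMaxμ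
  have hneg := integral_surplus_lt (R := R) hC hMin hqe.1.le hlt hload hΛ hbdd
  rw [hqe_eq] at hneg
  have hrev := hqm_max 0 ⟨le_rfl, zero_le_one⟩
  rw [zero_mul, zero_mul] at hrev
  exact hrev.not_gt (mul_neg_of_pos_of_neg (mul_pos (hqe.1.trans hlt) hlam) hneg)
end

section
/- Let p ≥ 0. Suppose q_s ∈ [0, 1] satisfies 𝔼[R − p − C/(μ − q_s·Λ)] = 0 and q_e ∈ [0, 1] satisfies 𝔼[R − C/(μ − q_e·Λ)] = 0. Then q_s ≤ q_e, with equality when p = 0. (The social optimizer's equilibrium joining probability under a non-negative fee is at most the individual equilibrium joining probability: q^S_s ≤ q^S_e.) -/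
open MeasureTheory

/-- The cost `C / (μ - q * Λ)` of waiting is integrable when `Λ` is bounded away from `μ`. -/
theorem integrable_waitingCost {Ω : Type*} [MeasureSpace Ω]
    [IsFiniteMeasure (volume : Measure Ω)] {μ C b q : ℝ} {Λ : Ω → ℝ} (hC : 0 ≤ C)
    (hbμ : b < μ) (hΛ : Measurable Λ) (hbdd : ∀ᵐ ω, 0 ≤ Λ ω ∧ Λ ω ≤ b)
    (hq : q ∈ Set.Icc (0 : ℝ) 1) :
    Integrable (fun ω => C / (μ - q * Λ ω)) := by
  have hmeas : Measurable fun ω => C / (μ - q * Λ ω) := by fun_prop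
  refine Integrable.of_bound hmeas.aestronglyMeasurable (C / (μ - b)) ?_
  filter_upwards [hbdd] with ω ⟨h0, hb⟩
  have hle : q * Λ ω ≤ b := (mul_le_of_le_one_left h0 hq.2).trans hb
  rw [Real.norm_of_nonneg (div_nonneg hC (by linarith))]
  exact div_le_div_of_nonneg_left hC (by linarith) (by linarith)

/-- The expected cost of waiting is strictly increasing in the joining probability. -/
theorem integral_waitingCost_lt {Ω : Type*} [MeasureSpace Ω]
    [IsProbabilityMeasure (volume : Measure Ω)] {μ C b q r : ℝ} {Λ : Ω → ℝ} (hC : 0 < C)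
    (hbμ : b < μ) (hΛ : Measurable Λ) (hbdd : ∀ᵐ ω, 0 < Λ ω ∧ Λ ω ≤ b)
    (hq : q ∈ Set.Icc (0 : ℝ) 1) (hr : r ∈ Set.Icc (0 : ℝ) 1) (hqr : q < r) :
    ∫ ω, C / (μ - q * Λ ω) < ∫ ω, C / (μ - r * Λ ω) := by
  have hbdd' : ∀ᵐ ω, 0 ≤ Λ ω ∧ Λ ω ≤ b := hbdd.mono fun ω h => ⟨h.1.le, h.2⟩
  have hlt : ∀ᵐ ω, C / (μ - q * Λ ω) < C / (μ - r * Λ ω) := by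
    filter_upwards [hbdd] with ω ⟨h0, hb⟩
    have hle : r * Λ ω ≤ b := (mul_le_of_le_one_left h0.le hr.2).trans hb
    have hmul : q * Λ ω < r * Λ ω := mul_lt_mul_of_pos_right hqr h0
    exact div_lt_div_of_pos_left hC (by linarith) (by linarith)
  have hiq := integrable_waitingCost hC.le hbμ hΛ hbdd' hq
  have hir := integrable_waitingCost hC.le hbμ hΛ hbdd' hr
  refine lt_of_le_of_ne (integral_mono_ae hiq hir (hlt.mono fun _ => le_of_lt)) fun heq => ?_
  have hae := (integral_eq_iff_of_ae_le hiq hir (hlt.mono fun _ => le_of_lt)).1 heq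
  obtain ⟨ω, h, h'⟩ := (hlt.and hae).exists
  exact h.ne h'

/-- If `p ≥ 0`, `q_s ∈ [0,1]` solves `𝔼[R − p − C/(μ − q_s Λ)] = 0` and `q_e ∈ [0,1]`
solves `𝔼[R − C/(μ − q_e Λ)] = 0`, then `q_s ≤ q_e`, with equality when `p = 0`. -/
theorem stmt5
    {Ω : Type*} [MeasureSpace Ω] [IsProbabilityMeasure (volume : Measure Ω)]
    (μ lam R C lamMin lamMax : ℝ)
    (hlam : 0 < lam) (hlamμ : lam < μ) (hC : 0 < C) (hR : C / μ ≤ R)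
    (hMin : 0 < lamMin) (hMinMax : lamMin ≤ lamMax) (hMaxμ : lamMax < μ)
    (Λ : Ω → ℝ) (hΛ : Measurable Λ)
    (hbdd : ∀ᵐ ω, lamMin ≤ Λ ω ∧ Λ ω ≤ lamMax)
    (p : ℝ) (hp : 0 ≤ p)
    (qs : ℝ) (hqs : qs ∈ Set.Icc (0 : ℝ) 1)
    (hqs_eq : (∫ ω, (R - p - C / (μ - qs * Λ ω))) = 0)
    (qe : ℝ) (hqe : qe ∈ Set.Icc (0 : ℝ) 1)
    (hqe_eq : (∫ ω, (R - C / (μ - qe * Λ ω))) = 0) :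
    qs ≤ qe ∧ (p = 0 → qs = qe) := by
  have hpos : ∀ᵐ ω, 0 < Λ ω ∧ Λ ω ≤ lamMax :=
    hbdd.mono fun ω h => ⟨hMin.trans_le h.1, h.2⟩
  have hpos' : ∀ᵐ ω, 0 ≤ Λ ω ∧ Λ ω ≤ lamMax := hpos.mono fun ω h => ⟨h.1.le, h.2⟩
  rw [integral_sub (integrable_const _) (integrable_waitingCost hC.le hMaxμ hΛ hpos' hqs)]
    at hqs_eq
  rw [integral_sub (integrable_const _) (integrable_waitingCost hC.le hMaxμ hΛ hpos' hqe)]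
    at hqe_eq
  simp only [integral_const, probReal_univ, one_smul] at hqs_eq hqe_eq
  have hle : qs ≤ qe := by
    by_contra! h
    linarith [integral_waitingCost_lt hC hMaxμ hΛ hpos hqe hqs h]
  refine ⟨hle, fun hp0 => hle.antisymm ?_⟩
  by_contra! h
  linarith [integral_waitingCost_lt hC hMaxμ hΛ hpos hqs hqe h]
end

section
/- Suppose q_s ∈ (0, 1) satisfies R = C·μ/(μ − q_s·λ)² (i.e., q_s is a critical point of the social welfare SW^S(q) = qλ(R − C/(μ − qλ))) and that the beliefs satisfy the unbiased second-moment condition 𝔼[1/(μ − q_s·Λ)²] = 1/(μ − q_s·λ)². Then q_s maximizes the shared-belief revenue: Rev^S(q) ≤ Rev^S(q_s) for all q ∈ [0, 1]. (Under the unbiasedness condition the revenue maximizer's and social optimizer's equilibria coincide: q^S_m = q^S_s.) -/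
open MeasureTheory

/-- The tangent-line inequality for the concave function `q ↦ q (R - C / (μ - q x))` at `p`. -/
lemma revenue_le_tangent {μ R C x p q : ℝ} (hμ : 0 ≤ μ) (hC : 0 ≤ C) (hx : 0 ≤ x)
    (hp : 0 < μ - p * x) (hq : 0 < μ - q * x) :
    q * (R - C / (μ - q * x)) ≤
      p * (R - C / (μ - p * x)) + (q - p) * (R - C * μ * (1 / (μ - p * x) ^ 2)) := by
  have key : p * (R - C / (μ - p * x)) + (q - p) * (R - C * μ * (1 / (μ - p * x) ^ 2))
      - q * (R - C / (μ - q * x))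
      = C * μ * (q - p) ^ 2 * x / ((μ - q * x) * (μ - p * x) ^ 2) := by
    generalize ha : μ - q * x = a at *
    generalize hb : μ - p * x = b at *
    field_simp
    rw [← ha, ← hb]
    ring
  have : 0 ≤ C * μ * (q - p) ^ 2 * x / ((μ - q * x) * (μ - p * x) ^ 2) := by positivity
  linarith

lemma sub_le_sub_mul_of_le {μ b x q : ℝ} (hb : 0 ≤ b) (hq : q ∈ Set.Icc (0 : ℝ) 1)
    (hx : x ≤ b) : μ - b ≤ μ - q * x := by
  nlinarith [mul_le_mul_of_nonneg_left hx hq.1, mul_le_mul_of_nonneg_right hq.2 hb]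

/-- A measurable function bounded below by a positive constant has an integrable inverse. -/
lemma integrable_inv_of_le {Ω : Type*} [MeasurableSpace Ω] {P : Measure Ω} [IsFiniteMeasure P]
    {f : Ω → ℝ} {d : ℝ} (hf : Measurable f) (hd : 0 < d) (h : ∀ᵐ ω ∂P, d ≤ f ω) :
    Integrable (fun ω => (f ω)⁻¹) P := by
  refine Integrable.of_bound hf.inv.aestronglyMeasurable d⁻¹ ?_
  filter_upwards [h] with ω hω
  rw [Real.norm_of_nonneg (inv_nonneg.2 (hd.le.trans hω))]
  exact inv_anti₀ hd hω

/-- If `q_s ∈ (0,1)` is a critical point of the social welfare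
(`R = Cμ/(μ − q_s λ)²`) and the beliefs satisfy the unbiased second-moment condition
`𝔼[1/(μ − q_s Λ)²] = 1/(μ − q_s λ)²`, then `q_s` maximizes the shared-belief revenue
`Rev^S(q) = qλ𝔼[R − C/(μ − qΛ)]` over `[0,1]`. -/
theorem stmt6
    {Ω : Type*} [MeasureSpace Ω] [IsProbabilityMeasure (volume : Measure Ω)]
    (μ lam R C lamMin lamMax : ℝ)
    (hlam : 0 < lam) (hlamμ : lam < μ) (hC : 0 < C) (hR : C / μ ≤ R)
    (hMin : 0 < lamMin) (hMinMax : lamMin ≤ lamMax) (hMaxμ : lamMax < μ)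
    (Λ : Ω → ℝ) (hΛ : Measurable Λ)
    (hbdd : ∀ᵐ ω, lamMin ≤ Λ ω ∧ Λ ω ≤ lamMax)
    (qs : ℝ) (hqs : qs ∈ Set.Ioo (0 : ℝ) 1)
    (hcrit : R = C * μ / (μ - qs * lam) ^ 2)
    (hunbiased : (∫ ω, 1 / (μ - qs * Λ ω) ^ 2) = 1 / (μ - qs * lam) ^ 2) :
    ∀ q ∈ Set.Icc (0 : ℝ) 1,
      q * lam * ∫ ω, (R - C / (μ - q * Λ ω)) ≤ qs * lam * ∫ ω, (R - C / (μ - qs * Λ ω)) := by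
  intro q hq
  have hqs' : qs ∈ Set.Icc (0 : ℝ) 1 := Set.Ioo_subset_Icc_self hqs
  have hd : 0 < μ - lamMax := sub_pos.2 hMaxμ
  have hb : 0 ≤ lamMax := (hMin.trans_le hMinMax).le
  have hμ : 0 ≤ μ := (hlam.trans hlamμ).le
  have hmeas (p : ℝ) : Measurable fun ω => μ - p * Λ ω := by fun_prop
  have hle {p : ℝ} (hp : p ∈ Set.Icc (0 : ℝ) 1) : ∀ᵐ ω, μ - lamMax ≤ μ - p * Λ ω := by
    filter_upwards [hbdd] with ω hω
    exact sub_le_sub_mul_of_le hb hp hω.2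
  have hint {p : ℝ} (hp : p ∈ Set.Icc (0 : ℝ) 1) :
      Integrable fun ω => p * (R - C / (μ - p * Λ ω)) := by
    simp only [div_eq_mul_inv]
    exact ((integrable_const R).sub
      ((integrable_inv_of_le (hmeas p) hd (hle hp)).const_mul C)).const_mul p
  have hsq : Integrable fun ω => C * μ * (1 / (μ - qs * Λ ω) ^ 2) := by
    simp only [one_div]
    refine (integrable_inv_of_le ((hmeas qs).pow_const 2) (pow_pos hd 2) ?_).const_mul (C * μ)
    filter_upwards [hle hqs'] with ω hω
    exact pow_le_pow_left₀ hd.le hω 2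
  have hslope : Integrable fun ω => (q - qs) * (R - C * μ * (1 / (μ - qs * Λ ω) ^ 2)) :=
    ((integrable_const R).sub hsq).const_mul _
  have hslope_zero : ∫ ω, (q - qs) * (R - C * μ * (1 / (μ - qs * Λ ω) ^ 2)) = 0 := by
    rw [integral_const_mul, integral_sub (integrable_const R) hsq, integral_const_mul, hunbiased,
      integral_const, probReal_univ, one_smul, mul_one_div, ← hcrit, sub_self, mul_zero]
  have hmono : ∫ ω, q * (R - C / (μ - q * Λ ω)) ≤ ∫ ω, qs * (R - C / (μ - qs * Λ ω)) := by
    rw [← add_zero (∫ ω, qs * (R - C / (μ - qs * Λ ω))), ← hslope_zero,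
      ← integral_add (hint hqs') hslope]
    refine integral_mono_ae (hint hq) ((hint hqs').add hslope) ?_
    filter_upwards [hbdd, hle hq, hle hqs'] with ω hω h₁ h₂
    exact revenue_le_tangent hμ hC.le (hMin.le.trans hω.1) (hd.trans_le h₂) (hd.trans_le h₁)
  rw [integral_const_mul, integral_const_mul] at hmono
  rw [mul_right_comm q, mul_right_comm qs]
  exact mul_le_mul_of_nonneg_right hmono hlam.le
end

section
/- Suppose q_s ∈ (0, 1) satisfies R = C·μ/(μ − q_s·λ)² and the beliefs satisfy 𝔼[1/(μ − q_s·Λ)] = 1/(μ − q_s·λ). Suppose q_m ∈ [0, 1] satisfies Rev^S(q_m) ≥ Rev^S(q) for all q ∈ [0, 1], and suppose q̃_e ∈ (0, μ/λ_max) satisfies 𝔼[R − C/(μ − q̃_e·Λ)] = 0. Then q_m ≤ q_s ≤ min{q̃_e, 1}. (In the shared belief case with unbiased expected waiting time: q^S_m ≤ q^S_s ≤ q^S_e.) -/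
open MeasureTheory

section BoundedRate

variable {Ω : Type*} [MeasureSpace Ω] [IsProbabilityMeasure (volume : Measure Ω)]
  {μ lamMin lamMax q : ℝ} {Λ : Ω → ℝ}

/-- The waiting time at a bounded effective arrival rate is integrable. -/
lemma integrable_waitingTime (hΛ : Measurable Λ) (hbdd : ∀ᵐ ω, lamMin ≤ Λ ω ∧ Λ ω ≤ lamMax)
    (hq : 0 ≤ q) (hqμ : q * lamMax < μ) :
    Integrable (fun ω => 1 / (μ - q * Λ ω)) := by
  refine Integrable.of_bound (C := 1 / (μ - q * lamMax)) ?_ ?_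
  · exact (measurable_const.div (measurable_const.sub (hΛ.const_mul q))).aestronglyMeasurable
  · filter_upwards [hbdd] with ω hω
    have h : q * Λ ω ≤ q * lamMax := mul_le_mul_of_nonneg_left hω.2 hq
    have hpos : 0 < μ - q * Λ ω := by linarith
    rw [Real.norm_of_nonneg (by positivity)]
    exact one_div_le_one_div_of_le (by linarith) (by linarith)

/-- The expected net utility in terms of the expected waiting time. -/
lemma integral_netUtility (R C : ℝ) (h : Integrable (fun ω => 1 / (μ - q * Λ ω))) :
    ∫ ω, (R - C / (μ - q * Λ ω)) = R - C * ∫ ω, 1 / (μ - q * Λ ω) := by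
  have hfun : (fun ω => R - C / (μ - q * Λ ω)) = fun ω => R - C * (1 / (μ - q * Λ ω)) := by
    funext ω
    rw [mul_one_div]
  rw [hfun, integral_sub (integrable_const R) (h.const_mul C), integral_const_mul]
  simp

end BoundedRate

/-- A strict tangent-type lower bound on `q / (μ - q * x)`, affine in `1 / (μ - p * x)`. -/
lemma affine_lower_bound {μ p q x m y : ℝ} (hμ : 0 < μ) (hm : 0 < m) (hmx : m ≤ x)
    (hp : 0 ≤ p) (hpq : p < q) (hq : 0 < μ - q * x) :
    p * (1 / (μ - p * x)) + μ * (q - p) *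
        ((2 * y + (q - p) * m / μ ^ 2) * (1 / (μ - p * x)) - y ^ 2)
      ≤ q * (1 / (μ - q * x)) := by
  have hx : 0 < x := hm.trans_le hmx
  have hpx : 0 < μ - p * x := by nlinarith
  set Y := 1 / (μ - p * x) with hY
  set Z := 1 / (μ - q * x) with hZ
  have hYpos : 0 < Y := by positivity
  have hZpos : 0 < Z := by positivity
  have hY_mul : Y * (μ - p * x) = 1 := one_div_mul_cancel hpx.ne'
  have hZ_mul : Z * (μ - q * x) = 1 := one_div_mul_cancel hq.ne'
  have hdiff : q * Z - p * Y = μ * (q - p) * (Y * Z) := by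
    linear_combination p * Y * hZ_mul - q * Z * hY_mul
  have hZY : Z - Y = (q - p) * x * (Y * Z) := by
    linear_combination Y * hZ_mul - Z * hY_mul
  have hYμ : 1 / μ ≤ Y := one_div_le_one_div_of_le hpx (by nlinarith)
  have hZμ : 1 / μ ≤ Z := one_div_le_one_div_of_le hq (by nlinarith)
  have hgap : (q - p) * m / μ ^ 2 ≤ Z - Y := by
    rw [hZY]
    calc (q - p) * m / μ ^ 2 = (q - p) * m * (1 / μ * (1 / μ)) := by field_simp
      _ ≤ (q - p) * x * (Y * Z) := by
        have : 0 ≤ q - p := by linarith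
        gcongr
  have hYZ : (2 * y + (q - p) * m / μ ^ 2) * Y - y ^ 2 ≤ Y * Z := by
    nlinarith [mul_le_mul_of_nonneg_right hgap hYpos.le, sq_nonneg (Y - y)]
  have hcoef : 0 ≤ μ * (q - p) := mul_nonneg hμ.le (by linarith)
  linarith [mul_le_mul_of_nonneg_left hYZ hcoef]

/-- In the shared-belief case with unbiased expected waiting time:
`q^S_m ≤ q^S_s ≤ q^S_e`. -/
theorem stmt8
    {Ω : Type*} [MeasureSpace Ω] [IsProbabilityMeasure (volume : Measure Ω)]
    (μ lam R C lamMin lamMax : ℝ)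
    (hlam : 0 < lam) (hlamμ : lam < μ) (hC : 0 < C) (hR : C / μ ≤ R)
    (hMin : 0 < lamMin) (hMinMax : lamMin ≤ lamMax) (hMaxμ : lamMax < μ)
    (Λ : Ω → ℝ) (hΛ : Measurable Λ)
    (hbdd : ∀ᵐ ω, lamMin ≤ Λ ω ∧ Λ ω ≤ lamMax)
    (qs : ℝ) (hqs : qs ∈ Set.Ioo (0 : ℝ) 1)
    (hcrit : R = C * μ / (μ - qs * lam) ^ 2)
    (hunbiased : (∫ ω, 1 / (μ - qs * Λ ω)) = 1 / (μ - qs * lam))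
    (qm : ℝ) (hqm : qm ∈ Set.Icc (0 : ℝ) 1)
    (hqm_max : ∀ q ∈ Set.Icc (0 : ℝ) 1,
      q * lam * ∫ ω, (R - C / (μ - q * Λ ω)) ≤ qm * lam * ∫ ω, (R - C / (μ - qm * Λ ω)))
    (qe : ℝ) (hqe : qe ∈ Set.Ioo (0 : ℝ) (μ / lamMax))
    (hqe_eq : (∫ ω, (R - C / (μ - qe * Λ ω))) = 0) :
    qm ≤ qs ∧ qs ≤ min qe 1 := by
  obtain ⟨hqs0, hqs1⟩ := hqs
  obtain ⟨hqm0, hqm1⟩ := hqm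
  obtain ⟨hqe0, hqe1⟩ := hqe
  have hμ : 0 < μ := hlam.trans hlamμ
  have hMax : 0 < lamMax := hMin.trans_le hMinMax
  have hunit : ∀ q : ℝ, q ≤ 1 → q * lamMax < μ := fun q hq => by nlinarith
  have hIs := integrable_waitingTime hΛ hbdd hqs0.le (hunit qs hqs1.le)
  have hden : 0 < μ - qs * lam := by nlinarith
  set y := 1 / (μ - qs * lam) with hy
  have hypos : 0 < y := by positivity
  have hRy : R = C * μ * y ^ 2 := by
    rw [hcrit, hy]
    field_simp
  refine ⟨?_, le_min ?_ hqs1.le⟩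
  · by_contra! hlt
    have hIm := integrable_waitingTime hΛ hbdd hqm0 (hunit qm hqm1)
    have hmax := hqm_max qs ⟨hqs0.le, hqs1.le⟩
    rw [integral_netUtility R C hIs, integral_netUtility R C hIm, hunbiased] at hmax
    set δ := (qm - qs) * lamMin / μ ^ 2 with hδ
    have hgap : 0 < qm - qs := sub_pos.mpr hlt
    have hδpos : 0 < δ := by positivity
    have hInner : Integrable (fun ω => (2 * y + δ) * (1 / (μ - qs * Λ ω)) - y ^ 2) :=
      (hIs.const_mul _).sub (integrable_const _)
    have hle : ∫ ω, (qs * (1 / (μ - qs * Λ ω)) + μ * (qm - qs) *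
        ((2 * y + δ) * (1 / (μ - qs * Λ ω)) - y ^ 2)) ≤ ∫ ω, qm * (1 / (μ - qm * Λ ω)) := by
      refine integral_mono_ae ((hIs.const_mul _).add (hInner.const_mul _)) (hIm.const_mul _) ?_
      filter_upwards [hbdd] with ω hω
      have := mul_le_mul_of_nonneg_left hω.2 hqm0
      exact affine_lower_bound hμ hMin hω.1 hqs0.le hlt (by linarith [hunit qm hqm1])
    rw [integral_add (hIs.const_mul _) (hInner.const_mul _), integral_const_mul,
      integral_const_mul, integral_sub (hIs.const_mul _) (integrable_const _),
      integral_const_mul, integral_const_mul, hunbiased] at hle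
    simp only [integral_const, probReal_univ, one_smul] at hle
    set M := ∫ ω, 1 / (μ - qm * Λ ω)
    have hmax' : qs * (R - C * y) ≤ qm * (R - C * M) := by
      refine le_of_mul_le_mul_left ?_ hlam
      linarith
    have hpos : 0 < C * (μ * (qm - qs) * (δ * y)) := by positivity
    have hleC := mul_le_mul_of_nonneg_left hle hC.le
    rw [hRy] at hmax'
    linarith
  · by_contra! hlt
    have hqeμ : qe * lamMax < μ := (lt_div_iff₀ hMax).mp hqe1
    have hIe := integrable_waitingTime hΛ hbdd hqe0.le hqeμ
    rw [integral_netUtility R C hIe] at hqe_eq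
    have hle : ∫ ω, 1 / (μ - qe * Λ ω) ≤ ∫ ω, 1 / (μ - qs * Λ ω) := by
      refine integral_mono_ae hIe hIs ?_
      filter_upwards [hbdd] with ω hω
      have := mul_le_mul_of_nonneg_left hω.2 hqs0.le
      have := hunit qs hqs1.le
      exact one_div_le_one_div_of_le (by linarith) (by nlinarith)
    rw [hunbiased] at hle
    have hμy : 1 < μ * y := by
      rw [hy, mul_one_div, one_lt_div hden]
      nlinarith
    have hleC := mul_le_mul_of_nonneg_left hle hC.le
    have hpos : 0 < C * y * (μ * y - 1) := mul_pos (by positivity) (by linarith)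
    rw [hRy] at hqe_eq
    linarith
end

section
/- Assume λ ≤ 𝔼[Λ] and fix a price p with 0 ≤ p ≤ R − C/μ. Suppose q_S ∈ [0, 1] is a shared-belief equilibrium at price p, meaning either (q_S < 1 and C·𝔼[W_G(q_S·Λ)] = R − p) or (q_S = 1 and C·𝔼[W_G(Λ)] ≤ R − p); and suppose q_C ∈ [0, 1] is a classical equilibrium at price p, meaning either (q_C < 1 and C·W_G(q_C·λ) = R − p) or (q_C = 1 and C·W_G(λ) ≤ R − p). Then q_S ≤ q_C; in particular the shared-belief revenue p·λ·q_S is at most the classical revenue p·λ·q_C. -/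
open MeasureTheory

theorem WG_sub {μ s x a : ℝ} (hμ : 0 < μ) (hx : x < μ) (ha : a < μ) :
    WG μ s x - WG μ s a = s ^ 2 * μ ^ 2 * (x - a) / (2 * (μ - x) * (μ - a)) := by
  have hx' : μ - x ≠ 0 := (sub_pos.2 hx).ne'
  have ha' : μ - a ≠ 0 := (sub_pos.2 ha).ne'
  have key : ∀ y : ℝ, 1 - y / μ = (μ - y) / μ := fun y => by field_simp
  unfold WG
  rw [key, key]
  field_simp
  ring

theorem WG_strictMonoOn {μ s : ℝ} (hμ : 0 < μ) (hs : 0 < s) :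
    StrictMonoOn (WG μ s) (Set.Iio μ) := by
  intro a ha x hx hax
  have hx' := sub_pos.2 (Set.mem_Iio.1 hx)
  have ha' := sub_pos.2 (Set.mem_Iio.1 ha)
  have hd := sub_pos.2 hax
  rw [← sub_pos, WG_sub hμ hx ha]
  positivity

/-- The graph of `WG` lies above its tangent at `a`. -/
theorem WG_tangent_le {μ s x a : ℝ} (hμ : 0 < μ) (hx : x < μ) (ha : a < μ) :
    WG μ s a + s ^ 2 * μ ^ 2 / (2 * (μ - a) ^ 2) * (x - a) ≤ WG μ s x := by
  have hx' := sub_pos.2 hx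
  have ha' := sub_pos.2 ha
  have h : WG μ s x - WG μ s a - s ^ 2 * μ ^ 2 / (2 * (μ - a) ^ 2) * (x - a)
      = s ^ 2 * μ ^ 2 * (x - a) ^ 2 / (2 * (μ - x) * (μ - a) ^ 2) := by
    rw [WG_sub hμ hx ha]
    field_simp
    ring
  have : 0 ≤ s ^ 2 * μ ^ 2 * (x - a) ^ 2 / (2 * (μ - x) * (μ - a) ^ 2) := by positivity
  linarith

theorem measurable_WG (μ s : ℝ) : Measurable (WG μ s) := by
  unfold WG
  fun_prop

theorem integrable_WG_comp {Ω : Type*} [MeasurableSpace Ω] {P : Measure Ω} [IsFiniteMeasure P]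
    {μ s a b : ℝ} (hμ : 0 < μ) (hs : 0 < s) (hb : b < μ) {X : Ω → ℝ} (hX : AEMeasurable X P)
    (hbdd : ∀ᵐ ω ∂P, X ω ∈ Set.Icc a b) : Integrable (fun ω => WG μ s (X ω)) P := by
  refine Integrable.of_mem_Icc (WG μ s a) (WG μ s b) ((measurable_WG μ s).comp_aemeasurable hX) ?_
  filter_upwards [hbdd] with ω hω
  have hmono := (WG_strictMonoOn hμ hs).monotoneOn
  exact ⟨hmono (hω.1.trans_lt (hω.2.trans_lt hb)) (hω.2.trans_lt hb) hω.1,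
    hmono (hω.2.trans_lt hb) hb hω.2⟩

/-- Jensen's inequality for `WG`, combined with its monotonicity. -/
theorem WG_le_integral_of_le_integral {Ω : Type*} [MeasurableSpace Ω] {P : Measure Ω}
    [IsProbabilityMeasure P] {μ s a b c : ℝ} (hμ : 0 < μ) (hs : 0 < s) (hb : b < μ) (hc : c < μ)
    {X : Ω → ℝ} (hX : AEMeasurable X P) (hbdd : ∀ᵐ ω ∂P, X ω ∈ Set.Icc a b)
    (hmean : c ≤ ∫ ω, X ω ∂P) : WG μ s c ≤ ∫ ω, WG μ s (X ω) ∂P := by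
  have hXi : Integrable X P := Integrable.of_mem_Icc a b hX hbdd
  have hk : 0 ≤ s ^ 2 * μ ^ 2 / (2 * (μ - c) ^ 2) := by positivity
  have hdi : Integrable (fun ω => s ^ 2 * μ ^ 2 / (2 * (μ - c) ^ 2) * (X ω - c)) P :=
    (hXi.sub (integrable_const c)).const_mul _
  calc WG μ s c
      ≤ WG μ s c + s ^ 2 * μ ^ 2 / (2 * (μ - c) ^ 2) * (∫ ω, X ω ∂P - c) :=
        le_add_of_nonneg_right (mul_nonneg hk (sub_nonneg.2 hmean))
    _ = ∫ ω, (WG μ s c + s ^ 2 * μ ^ 2 / (2 * (μ - c) ^ 2) * (X ω - c)) ∂P := by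
        rw [integral_add (integrable_const _) hdi, integral_const_mul,
          integral_sub hXi (integrable_const c)]
        simp
    _ ≤ ∫ ω, WG μ s (X ω) ∂P := by
        refine integral_mono_ae ((integrable_const _).add hdi)
          (integrable_WG_comp hμ hs hb hX hbdd) ?_
        filter_upwards [hbdd] with ω hω
        exact WG_tangent_le hμ (hω.2.trans_lt hb) hc

/-- If `λ ≤ 𝔼[Λ]` and `0 ≤ p ≤ R − C/μ`, then any shared-belief equilibrium joining
probability at price `p` is at most any classical equilibrium joining probability at
price `p`; in particular `Rev^S(p) = pλq_S ≤ pλq_C = Rev^C(p)`. -/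
theorem stmt9
    {Ω : Type*} [MeasureSpace Ω] [IsProbabilityMeasure (volume : Measure Ω)]
    (μ lam R C s lamMin lamMax : ℝ)
    (hlam : 0 < lam) (hlamμ : lam < μ) (hC : 0 < C) (hR : C / μ ≤ R) (hs : 0 < s)
    (hMin : 0 < lamMin) (hMinMax : lamMin ≤ lamMax) (hMaxμ : lamMax < μ)
    (Λ : Ω → ℝ) (hΛ : Measurable Λ)
    (hbdd : ∀ᵐ ω, lamMin ≤ Λ ω ∧ Λ ω ≤ lamMax)
    (hmean : lam ≤ ∫ ω, Λ ω)
    (p : ℝ) (hp : 0 ≤ p) (hpR : p ≤ R - C / μ)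
    (qS : ℝ) (hqS : qS ∈ Set.Icc (0 : ℝ) 1)
    (hqS_eq : (qS < 1 ∧ C * ∫ ω, WG μ s (qS * Λ ω) = R - p) ∨
      (qS = 1 ∧ C * ∫ ω, WG μ s (Λ ω) ≤ R - p))
    (qC : ℝ) (hqC : qC ∈ Set.Icc (0 : ℝ) 1)
    (hqC_eq : (qC < 1 ∧ C * WG μ s (qC * lam) = R - p) ∨
      (qC = 1 ∧ C * WG μ s lam ≤ R - p)) :
    qS ≤ qC ∧ p * lam * qS ≤ p * lam * qC := by
  have hμ : 0 < μ := hlam.trans hlamμ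
  have hle : qS ≤ qC := by
    by_contra! hlt
    have hC_eq : C * WG μ s (qC * lam) = R - p := by
      rcases hqC_eq with h | h
      · exact h.2
      · linarith [h.1, hqS.2]
    have hS_le : C * ∫ ω, WG μ s (qS * Λ ω) ≤ R - p := by
      rcases hqS_eq with h | ⟨h1, h2⟩
      · exact h.2.le
      · simpa [h1] using h2
    have hqSlam : qS * lam < μ := by nlinarith [hqS.2]
    have hqlt : qC * lam < qS * lam := mul_lt_mul_of_pos_right hlt hlam
    have hmax : qS * lamMax < μ := by nlinarith [hqS.2]
    have hjensen : WG μ s (qS * lam) ≤ ∫ ω, WG μ s (qS * Λ ω) := by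
      refine WG_le_integral_of_le_integral (a := qS * lamMin) hμ hs hmax hqSlam
        (hΛ.const_mul qS).aemeasurable ?_ ?_
      · filter_upwards [hbdd] with ω hω
        exact ⟨mul_le_mul_of_nonneg_left hω.1 hqS.1, mul_le_mul_of_nonneg_left hω.2 hqS.1⟩
      · rw [integral_const_mul]
        exact mul_le_mul_of_nonneg_left hmean hqS.1
    have hmono : WG μ s (qC * lam) < WG μ s (qS * lam) :=
      WG_strictMonoOn hμ hs (hqlt.trans hqSlam) hqSlam hqlt
    nlinarith [mul_lt_mul_of_pos_left (hmono.trans_le hjensen) hC]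
  exact ⟨hle, mul_le_mul_of_nonneg_left hle (mul_nonneg hp hlam.le)⟩
end

section
/- Let p > 0 and let ξ ∈ (0, λ_max) satisfy ℙ(Λ > ξ) > 0. Set E_Q = 𝔼[min{ξ/Λ, 1}] and M(ξ) = ξ/E_Q, and define the private-belief revenue Rev^P = p·λ·E_Q and the classical revenue Rev^C = p·min{ξ, λ}. Then: Rev^P > Rev^C if and only if λ > M(ξ); Rev^P = Rev^C if and only if λ = M(ξ); and Rev^P < Rev^C if and only if λ < M(ξ). -/
open MeasureTheory

/-- If `Λ` is a.e. in `[a, b]` with `0 < a` and exceeds `ξ > 0` with positive probability, then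
`𝔼[min{ξ/Λ, 1}]` lies strictly between `0` and `1`. -/
lemma integral_min_div_one_mem_Ioo {Ω : Type*} [MeasurableSpace Ω] {μ : Measure Ω}
    [IsProbabilityMeasure μ] {a b ξ : ℝ} (ha : 0 < a) (hξ : 0 < ξ) {Λ : Ω → ℝ}
    (hΛ : Measurable Λ) (hbdd : ∀ᵐ ω ∂μ, a ≤ Λ ω ∧ Λ ω ≤ b) (htail : 0 < μ {ω | ξ < Λ ω}) :
    ∫ ω, min (ξ / Λ ω) 1 ∂μ ∈ Set.Ioo (0 : ℝ) 1 := by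
  have hpos : ∀ᵐ ω ∂μ, 0 < min (ξ / Λ ω) 1 := by
    filter_upwards [hbdd] with ω hω
    exact lt_min (div_pos hξ (ha.trans_le hω.1)) one_pos
  have hint : Integrable (fun ω => min (ξ / Λ ω) 1) μ := by
    refine Integrable.of_bound (by fun_prop : Measurable _).aestronglyMeasurable 1 ?_
    filter_upwards [hpos] with ω hω
    rw [Real.norm_of_nonneg hω.le]
    exact min_le_right _ _
  constructor
  · rw [integral_pos_iff_support_of_nonneg_ae (hpos.mono fun _ h => h.le) hint]
    refine htail.trans_le (measure_mono fun ω hω => ?_)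
    exact (lt_min (div_pos hξ (hξ.trans hω)) one_pos).ne'
  · have hgap : 0 < ∫ ω, (1 - min (ξ / Λ ω) 1) ∂μ := by
      rw [integral_pos_iff_support_of_nonneg_ae
        (ae_of_all _ fun ω => sub_nonneg.2 (min_le_right _ _)) ((integrable_const 1).sub hint)]
      refine htail.trans_le (measure_mono fun ω hω => ?_)
      exact (sub_pos.2 (min_lt_of_left_lt ((div_lt_one (hξ.trans hω)).2 hω))).ne'
    rw [integral_sub (integrable_const 1) hint] at hgap
    simpa using hgap

/-- Let `p > 0`, `ξ ∈ (0, λ_max)` with `ℙ(Λ > ξ) > 0`. With `E_Q = 𝔼[min{ξ/Λ, 1}]`,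
`M(ξ) = ξ/E_Q`, `Rev^P = pλE_Q` and `Rev^C = p·min{ξ, λ}`, we have
`Rev^P > Rev^C ↔ λ > M(ξ)`, `Rev^P = Rev^C ↔ λ = M(ξ)` and
`Rev^P < Rev^C ↔ λ < M(ξ)`. -/
theorem stmt11
    {Ω : Type*} [MeasureSpace Ω] [IsProbabilityMeasure (volume : Measure Ω)]
    (lam p lamMin lamMax ξ : ℝ)
    (hlam : 0 < lam) (hp : 0 < p)
    (hMin : 0 < lamMin) (hMinMax : lamMin ≤ lamMax)
    (Λ : Ω → ℝ) (hΛ : Measurable Λ)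
    (hbdd : ∀ᵐ ω, lamMin ≤ Λ ω ∧ Λ ω ≤ lamMax)
    (hξ : ξ ∈ Set.Ioo (0 : ℝ) lamMax)
    (htail : 0 < volume {ω | ξ < Λ ω}) :
    (p * lam * (∫ ω, min (ξ / Λ ω) 1) > p * min ξ lam ↔
      lam > ξ / ∫ ω, min (ξ / Λ ω) 1) ∧
    (p * lam * (∫ ω, min (ξ / Λ ω) 1) = p * min ξ lam ↔
      lam = ξ / ∫ ω, min (ξ / Λ ω) 1) ∧
    (p * lam * (∫ ω, min (ξ / Λ ω) 1) < p * min ξ lam ↔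
      lam < ξ / ∫ ω, min (ξ / Λ ω) 1) := by
  obtain ⟨hE0, hE1⟩ := integral_min_div_one_mem_Ioo hMin hξ.1 hΛ hbdd htail
  set E := ∫ ω, min (ξ / Λ ω) 1
  have hlt : lam * E < lam := mul_lt_of_lt_one_right hlam hE1
  rw [gt_iff_lt, gt_iff_lt, mul_assoc, mul_lt_mul_iff_right₀ hp, mul_right_inj' hp.ne',
    mul_lt_mul_iff_right₀ hp, div_lt_iff₀ hE0, eq_div_iff hE0.ne', lt_div_iff₀ hE0]
  rcases min_cases ξ lam with ⟨h, -⟩ | ⟨h, hle⟩ <;> rw [h]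
  · exact ⟨Iff.rfl, Iff.rfl, Iff.rfl⟩
  · refine ⟨?_, ?_, ?_⟩ <;> constructor <;> intro <;> linarith
end

section
/- Define M(ξ) = ξ / 𝔼[min{ξ/Λ, 1}] for ξ ∈ (0, λ_max]. Then M is continuous on (0, λ_max] and monotone nondecreasing on (0, λ_max]; moreover, whenever λ_min < ξ₁ < ξ₂ ≤ λ_max and ℙ(Λ < ξ₁) > 0, one has M(ξ₁) < M(ξ₂) (strict increase above λ_min). -/
open MeasureTheory

/-- The arrival probability `min {ξ / Λ, 1}` is integrable. -/
lemma integrable_min_div_one {Ω : Type*} [MeasurableSpace Ω] {μ : Measure Ω} [IsFiniteMeasure μ]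
    {Λ : Ω → ℝ} (hΛ : Measurable Λ) (hpos : ∀ᵐ ω ∂μ, 0 < Λ ω) {ξ : ℝ} (hξ : 0 ≤ ξ) :
    Integrable (fun ω => min (ξ / Λ ω) 1) μ := by
  refine Integrable.of_bound
    ((hΛ.const_div ξ).min measurable_const).aestronglyMeasurable 1 ?_
  filter_upwards [hpos] with ω hω
  rw [Real.norm_of_nonneg (le_min (by positivity) zero_le_one)]
  exact min_le_right _ _

lemma integral_min_div_one_pos {Ω : Type*} [MeasurableSpace Ω] {μ : Measure Ω}
    [IsFiniteMeasure μ] [NeZero μ] {Λ : Ω → ℝ} (hΛ : Measurable Λ) (hpos : ∀ᵐ ω ∂μ, 0 < Λ ω)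
    {ξ : ℝ} (hξ : 0 < ξ) : 0 < ∫ ω, min (ξ / Λ ω) 1 ∂μ := by
  have hf : ∀ᵐ ω ∂μ, 0 < min (ξ / Λ ω) 1 := by
    filter_upwards [hpos] with ω hω
    exact lt_min (by positivity) zero_lt_one
  rw [integral_pos_iff_support_of_nonneg_ae (hf.mono fun _ h => h.le)
    (integrable_min_div_one hΛ hpos hξ.le), pos_iff_ne_zero]
  intro h0
  have : ∀ᵐ ω ∂μ, False := by
    filter_upwards [hf, measure_eq_zero_iff_ae_notMem.1 h0] with ω h1 h2
    exact h2 h1.ne'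
  simp [NeZero.ne μ] at this

lemma continuousOn_integral_min_div_one {Ω : Type*} [MeasurableSpace Ω] {μ : Measure Ω}
    [IsFiniteMeasure μ] {Λ : Ω → ℝ} (hΛ : Measurable Λ) (hpos : ∀ᵐ ω ∂μ, 0 < Λ ω) :
    ContinuousOn (fun ξ => ∫ ω, min (ξ / Λ ω) 1 ∂μ) (Set.Ioi 0) := by
  refine continuousOn_of_dominated (bound := fun _ => 1)
    (fun ξ _ => ((hΛ.const_div ξ).min measurable_const).aestronglyMeasurable)
    (fun ξ hξ => ?_) (integrable_const _)
    (Filter.Eventually.of_forall fun ω => by fun_prop)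
  have hξ : 0 < ξ := hξ
  filter_upwards [hpos] with ω hω
  rw [Real.norm_of_nonneg (le_min (by positivity) zero_le_one)]
  exact min_le_right _ _

lemma mul_min_div_one_le {a b l : ℝ} (ha : 0 ≤ a) (hab : a ≤ b) :
    a * min (b / l) 1 ≤ b * min (a / l) 1 := by
  rw [mul_min_of_nonneg _ _ ha, mul_min_of_nonneg _ _ (ha.trans hab)]
  exact min_le_min (by rw [mul_div_left_comm]) (by simpa using hab)

lemma mul_min_div_one_lt {a b l : ℝ} (hl : 0 < l) (hla : l < a) (hab : a < b) :
    a * min (b / l) 1 < b * min (a / l) 1 := by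
  rw [min_eq_right ((one_le_div hl).2 (hla.trans hab).le), min_eq_right ((one_le_div hl).2 hla.le)]
  simpa using hab

/-- The threshold function `M(ξ) = ξ / 𝔼[min{ξ/Λ, 1}]` is continuous and monotone
nondecreasing on `(0, λ_max]`, and strictly increasing above `λ_min` in the sense
that `M(ξ₁) < M(ξ₂)` whenever `λ_min < ξ₁ < ξ₂ ≤ λ_max` and `ℙ(Λ < ξ₁) > 0`. -/
theorem stmt12
    {Ω : Type*} [MeasureSpace Ω] [IsProbabilityMeasure (volume : Measure Ω)]
    (lamMin lamMax : ℝ)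
    (hMin : 0 < lamMin) (hMinMax : lamMin ≤ lamMax)
    (Λ : Ω → ℝ) (hΛ : Measurable Λ)
    (hbdd : ∀ᵐ ω, lamMin ≤ Λ ω ∧ Λ ω ≤ lamMax) :
    ContinuousOn (fun ξ => ξ / ∫ ω, min (ξ / Λ ω) 1) (Set.Ioc (0 : ℝ) lamMax) ∧
    MonotoneOn (fun ξ => ξ / ∫ ω, min (ξ / Λ ω) 1) (Set.Ioc (0 : ℝ) lamMax) ∧
    ∀ ξ₁ ξ₂ : ℝ, lamMin < ξ₁ → ξ₁ < ξ₂ → ξ₂ ≤ lamMax →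
      0 < volume {ω | Λ ω < ξ₁} →
      ξ₁ / (∫ ω, min (ξ₁ / Λ ω) 1) < ξ₂ / ∫ ω, min (ξ₂ / Λ ω) 1 := by
  have hpos : ∀ᵐ ω, 0 < Λ ω := hbdd.mono fun ω h => hMin.trans_le h.1
  have hI : ∀ {ξ : ℝ}, 0 < ξ → 0 < ∫ ω, min (ξ / Λ ω) 1 := integral_min_div_one_pos hΛ hpos
  have hint : ∀ {ξ : ℝ}, 0 < ξ → ∀ c : ℝ, Integrable fun ω => c * min (ξ / Λ ω) 1 :=
    fun hξ c => (integrable_min_div_one hΛ hpos hξ.le).const_mul c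
  refine ⟨?_, ?_, ?_⟩
  · exact continuousOn_id.div ((continuousOn_integral_min_div_one hΛ hpos).mono fun _ h => h.1)
      fun _ h => (hI h.1).ne'
  · intro a ha b hb hab
    change a / _ ≤ b / _
    rw [div_le_div_iff₀ (hI ha.1) (hI hb.1), ← integral_const_mul, ← integral_const_mul]
    exact integral_mono (hint hb.1 a) (hint ha.1 b) fun ω => mul_min_div_one_le ha.1.le hab
  · intro a b hMa hab _ hP
    have ha : 0 < a := hMin.trans hMa
    have hb : 0 < b := ha.trans hab
    rw [div_lt_div_iff₀ (hI ha) (hI hb), ← integral_const_mul, ← integral_const_mul, ← sub_pos,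
      ← integral_sub (hint ha b) (hint hb a),
      integral_pos_iff_support_of_nonneg
        (fun ω => sub_nonneg.2 (mul_min_div_one_le ha.le hab.le))
        ((hint ha b).sub (hint hb a))]
    refine hP.trans_le (measure_mono_ae ?_)
    filter_upwards [hpos] with ω hω hωa
    exact (sub_pos.2 (mul_min_div_one_lt hω hωa hab)).ne'
end

section
/- Assume λ·𝔼[1/Λ] ≤ 1 (the true arrival rate is at most the harmonic mean of the beliefs). Then for every price p ∈ [0, R − C/μ], setting ξ(p) = μ − C/(R − p), one has p·λ·𝔼[min{ξ(p)/Λ, 1}] ≤ p·min{ξ(p), λ}. Consequently, the optimal private-belief revenue is at most the optimal classical revenue: sup over p ∈ [0, R − C/μ] of p·λ·𝔼[min{ξ(p)/Λ, 1}] is at most sup over p ∈ [0, R − C/μ] of p·min{ξ(p), λ}. -/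
open MeasureTheory

/-- The expectation of `min (ξ / Λ) 1`, for `ξ ≥ 0` and a belief `Λ` bounded away from `0`, is at
most the minimum of `ξ·𝔼[1/Λ]` and `1`. -/
theorem integral_min_div_one_le {Ω : Type*} [MeasurableSpace Ω] {P : Measure Ω}
    [IsProbabilityMeasure P] {Λ : Ω → ℝ} {a ξ : ℝ} (ha : 0 < a) (hξ : 0 ≤ ξ)
    (hΛ : Measurable Λ) (hle : ∀ᵐ ω ∂P, a ≤ Λ ω) :
    ∫ ω, min (ξ / Λ ω) 1 ∂P ≤ min (ξ * ∫ ω, 1 / Λ ω ∂P) 1 := by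
  have hint : Integrable (fun ω => 1 / Λ ω) P := by
    refine Integrable.of_bound (hΛ.const_div 1).aestronglyMeasurable (1 / a) ?_
    filter_upwards [hle] with ω hω
    rw [Real.norm_of_nonneg (one_div_nonneg.2 (ha.le.trans hω))]
    exact one_div_le_one_div_of_le ha hω
  have hnonneg : 0 ≤ᵐ[P] fun ω => min (ξ / Λ ω) 1 := by
    filter_upwards [hle] with ω hω
    exact le_min (div_nonneg hξ (ha.le.trans hω)) zero_le_one
  refine le_min ?_ ?_
  · rw [← integral_const_mul]
    refine integral_mono_of_nonneg hnonneg (hint.const_mul ξ) (.of_forall fun ω => ?_)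
    simpa only [mul_one_div] using min_le_left (ξ / Λ ω) 1
  · simpa using integral_mono_of_nonneg hnonneg (integrable_const (1 : ℝ))
      (.of_forall fun ω => min_le_right (ξ / Λ ω) 1)

/-- If `λ·𝔼[1/Λ] ≤ 1`, then for every price `p ∈ [0, R − C/μ]`, with
`ξ(p) = μ − C/(R − p)`, the private-belief revenue `pλ𝔼[min{ξ(p)/Λ, 1}]` is at most
the classical revenue `p·min{ξ(p), λ}`; consequently the optimal private-belief
revenue is at most the optimal classical revenue. -/
theorem stmt15
    {Ω : Type*} [MeasureSpace Ω] [IsProbabilityMeasure (volume : Measure Ω)]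
    (μ lam R C lamMin lamMax : ℝ)
    (hlam : 0 < lam) (hlamμ : lam < μ) (hC : 0 < C) (hR : C / μ ≤ R)
    (hMin : 0 < lamMin) (hMinMax : lamMin ≤ lamMax) (hMaxμ : lamMax < μ)
    (Λ : Ω → ℝ) (hΛ : Measurable Λ)
    (hbdd : ∀ᵐ ω, lamMin ≤ Λ ω ∧ Λ ω ≤ lamMax)
    (hharm : lam * (∫ ω, 1 / Λ ω) ≤ 1) :
    (∀ p ∈ Set.Icc (0 : ℝ) (R - C / μ),
      p * lam * (∫ ω, min ((μ - C / (R - p)) / Λ ω) 1) ≤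
        p * min (μ - C / (R - p)) lam) ∧
    sSup ((fun p => p * lam * ∫ ω, min ((μ - C / (R - p)) / Λ ω) 1) ''
        Set.Icc (0 : ℝ) (R - C / μ)) ≤
      sSup ((fun p => p * min (μ - C / (R - p)) lam) ''
        Set.Icc (0 : ℝ) (R - C / μ)) := by
  have hμ : 0 < μ := hlam.trans hlamμ
  have hpoint : ∀ p ∈ Set.Icc (0 : ℝ) (R - C / μ),
      p * lam * (∫ ω, min ((μ - C / (R - p)) / Λ ω) 1) ≤
        p * min (μ - C / (R - p)) lam := by
    intro p hp
    have hξ : 0 ≤ μ - C / (R - p) := by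
      have hgap : C / μ ≤ R - p := by linarith [hp.2]
      exact sub_nonneg.2 ((div_le_comm₀ hμ ((div_pos hC hμ).trans_le hgap)).1 hgap)
    have hE := le_min_iff.1
      (integral_min_div_one_le hMin hξ hΛ (hbdd.mono fun _ h => h.1))
    rw [mul_assoc]
    refine mul_le_mul_of_nonneg_left (le_min ?_ ?_) hp.1
    · calc
        _ ≤ lam * ((μ - C / (R - p)) * ∫ ω, 1 / Λ ω) :=
          mul_le_mul_of_nonneg_left hE.1 hlam.le
        _ = (μ - C / (R - p)) * (lam * ∫ ω, 1 / Λ ω) := mul_left_comm _ _ _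
        _ ≤ μ - C / (R - p) := mul_le_of_le_one_right hξ hharm
    · exact mul_le_of_le_one_right hlam.le hE.2
  refine ⟨hpoint, csSup_le ((Set.nonempty_Icc.2 (sub_nonneg.2 hR)).image _) ?_⟩
  have hbound : BddAbove ((fun p => p * min (μ - C / (R - p)) lam) ''
      Set.Icc (0 : ℝ) (R - C / μ)) := by
    refine ⟨(R - C / μ) * lam, ?_⟩
    rintro _ ⟨p, hp, rfl⟩
    exact (mul_le_mul_of_nonneg_left (min_le_right _ _) hp.1).trans
      (mul_le_mul_of_nonneg_right hp.2 hlam.le)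
  rintro _ ⟨p, hp, rfl⟩
  exact (hpoint p hp).trans (le_csSup hbound (Set.mem_image_of_mem _ hp))
end

section
/- Assume R ≥ C/μ and set ξ* = min{μ − √(Cμ/R), λ}. Then for every ξ ∈ [0, μ), (R − C/(μ − ξ))·min{ξ, λ} ≤ (R − C/(μ − ξ*))·min{ξ*, λ}. (The classical revenue, parametrized by the threshold effective arrival rate ξ with price p(ξ) = R − C/(μ − ξ), attains its maximum at ξ* = min{μ − √(Cμ/R), λ}.) -/
/-- The revenue `(R − C/(μ − x))·x` is compared at two points through the sign of a product. -/
theorem revenue_le_of_mul_nonneg {μ R C s x y : ℝ} (hR : 0 ≤ R) (hs : R * s ^ 2 = C * μ)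
    (hx : x < μ) (hy : y < μ) (h : 0 ≤ (y - x) * ((μ - x) * (μ - y) - s ^ 2)) :
    (R - C / (μ - x)) * x ≤ (R - C / (μ - y)) * y := by
  have hx' : 0 < μ - x := sub_pos.2 hx
  have hy' : 0 < μ - y := sub_pos.2 hy
  have key : (R - C / (μ - y)) * y - (R - C / (μ - x)) * x =
      R * ((y - x) * ((μ - x) * (μ - y) - s ^ 2)) / ((μ - x) * (μ - y)) := by
    field_simp
    linear_combination (y - x) * hs
  rw [← sub_nonneg, key]
  positivity

/-- With `R ≥ C/μ` and `ξ* = min{μ − √(Cμ/R), λ}`, the classical revenue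
`(R − C/(μ − ξ))·min{ξ, λ}` attains its maximum over `ξ ∈ [0, μ)` at `ξ*`. -/
theorem stmt16
    (μ lam R C : ℝ)
    (hlam : 0 < lam) (hlamμ : lam < μ) (hC : 0 < C) (hR : C / μ ≤ R) :
    ∀ ξ ∈ Set.Ico (0 : ℝ) μ,
      (R - C / (μ - ξ)) * min ξ lam ≤
        (R - C / (μ - min (μ - Real.sqrt (C * μ / R)) lam)) *
          min (min (μ - Real.sqrt (C * μ / R)) lam) lam := by
  rintro ξ ⟨hξ0, hξμ⟩
  have hμ : 0 < μ := hlam.trans hlamμ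
  have hR0 : 0 < R := (div_pos hC hμ).trans_le hR
  have hs : 0 < Real.sqrt (C * μ / R) := by positivity
  have hs2 : R * Real.sqrt (C * μ / R) ^ 2 = C * μ := by
    rw [Real.sq_sqrt (by positivity)]
    field_simp
  set s := Real.sqrt (C * μ / R)
  rw [min_eq_left (min_le_right (μ - s) lam)]
  have hxlam : min ξ lam ≤ lam := min_le_right _ _
  have hxξ : min ξ lam ≤ ξ := min_le_left _ _
  have hx0 : 0 ≤ min ξ lam := le_min hξ0 hlam.le
  set x := min ξ lam
  calc (R - C / (μ - ξ)) * x ≤ (R - C / (μ - x)) * x := by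
        have : 0 < μ - ξ := sub_pos.2 hξμ
        gcongr
    _ ≤ _ := by
        refine revenue_le_of_mul_nonneg hR0.le hs2 (by linarith)
          ((min_le_right _ _).trans_lt hlamμ) ?_
        rcases le_total (μ - s) lam with h | h
        · rw [min_eq_left h]
          nlinarith [mul_nonneg hs.le (sq_nonneg (μ - s - x))]
        · rw [min_eq_right h]
          refine mul_nonneg (by linarith) (sub_nonneg.2 ?_)
          rw [sq]
          exact mul_le_mul (by linarith) (by linarith) hs.le (by linarith)
end

section
/- Assume R > C/μ and set ξ^C = μ − √(Cμ/R), so ξ^C ∈ (0, μ). Suppose λ·𝔼[min{ξ^C/Λ, 1}] ≥ ξ^C (i.e., λ ≥ M(ξ^C)). Then the optimal private-belief revenue is at least the optimal classical revenue: sup over ξ ∈ [0, μ) of (R − C/(μ − ξ))·λ·𝔼[min{ξ/Λ, 1}] is at least sup over ξ ∈ [0, μ) of (R − C/(μ − ξ))·min{ξ, λ}. -/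
open MeasureTheory

/-- The M/M/1 revenue curve `ξ ↦ (R - C / (μ - ξ)) * ξ` is maximized at `μ - s`, where
`R * s ^ 2 = C * μ`. -/
theorem mm1_revenue_le {μ R C s ξ : ℝ} (hR : 0 < R) (hμ : 0 < μ) (hs : 0 < s)
    (hsC : R * s ^ 2 = C * μ) (hξ : ξ < μ) :
    (R - C / (μ - ξ)) * ξ ≤ (R - C / s) * (μ - s) := by
  have hy : 0 < μ - ξ := sub_pos.2 hξ
  have hCeq : C = R * s ^ 2 / μ := by field_simp; linarith
  have key : (R - C / s) * (μ - s) - (R - C / (μ - ξ)) * ξ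
      = R * (μ - ξ - s) ^ 2 / (μ - ξ) := by
    rw [hCeq]
    field_simp
    ring
  have : 0 ≤ R * (μ - ξ - s) ^ 2 / (μ - ξ) := by positivity
  linarith

/-- With `R > C/μ` and `ξ^C = μ − √(Cμ/R) ∈ (0, μ)`, if
`λ·𝔼[min{ξ^C/Λ, 1}] ≥ ξ^C` (i.e. `λ ≥ M(ξ^C)`), then the optimal private-belief
revenue is at least the optimal classical revenue. -/
theorem stmt17
    {Ω : Type*} [MeasureSpace Ω] [IsProbabilityMeasure (volume : Measure Ω)]
    (μ lam R C lamMin lamMax : ℝ)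
    (hlam : 0 < lam) (hlamμ : lam < μ) (hC : 0 < C) (hR : C / μ < R)
    (hMin : 0 < lamMin) (hMinMax : lamMin ≤ lamMax) (hMaxμ : lamMax < μ)
    (Λ : Ω → ℝ) (hΛ : Measurable Λ)
    (hbdd : ∀ᵐ ω, lamMin ≤ Λ ω ∧ Λ ω ≤ lamMax)
    (hM : μ - Real.sqrt (C * μ / R) ≤
      lam * ∫ ω, min ((μ - Real.sqrt (C * μ / R)) / Λ ω) 1) :
    sSup ((fun ξ => (R - C / (μ - ξ)) * min ξ lam) '' Set.Ico (0 : ℝ) μ) ≤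
      sSup ((fun ξ => (R - C / (μ - ξ)) * lam * ∫ ω, min (ξ / Λ ω) 1) ''
        Set.Ico (0 : ℝ) μ) := by
  have hμ : 0 < μ := hlam.trans hlamμ
  have hR0 : 0 < R := (div_pos hC hμ).trans hR
  have hsq : Real.sqrt (C * μ / R) ^ 2 = C * μ / R := Real.sq_sqrt (by positivity)
  have hs : 0 < Real.sqrt (C * μ / R) := Real.sqrt_pos.2 (by positivity)
  set s := Real.sqrt (C * μ / R)
  have hsC : R * s ^ 2 = C * μ := by rw [hsq]; field_simp
  have hCμ : C < R * μ := (div_lt_iff₀ hμ).1 hR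
  have hsμ : s < μ := by
    have : R * s ^ 2 < R * μ ^ 2 := by rw [hsC]; nlinarith
    exact lt_of_pow_lt_pow_left₀ 2 hμ.le (lt_of_mul_lt_mul_left this hR0.le)
  have hp : 0 ≤ R - C / s := by
    rw [sub_nonneg, div_le_iff₀ hs]
    nlinarith [mul_pos hR0 hs]
  have hopt : (R - C / s) * (μ - s) ≤
      sSup ((fun ξ => (R - C / (μ - ξ)) * lam * ∫ ω, min (ξ / Λ ω) 1) ''
        Set.Ico (0 : ℝ) μ) := by
    have hbound : BddAbove ((fun ξ => (R - C / (μ - ξ)) * lam * ∫ ω, min (ξ / Λ ω) 1) ''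
        Set.Ico (0 : ℝ) μ) := by
      refine ⟨R * lam, ?_⟩
      rintro _ ⟨ξ, ⟨hξ0, hξμ⟩, rfl⟩
      have hnonneg : ∀ᵐ ω, 0 ≤ min (ξ / Λ ω) 1 := by
        filter_upwards [hbdd] with ω hω
        exact le_min (div_nonneg hξ0 (hMin.le.trans hω.1)) zero_le_one
      have hI0 : 0 ≤ ∫ ω, min (ξ / Λ ω) 1 := integral_nonneg_of_ae hnonneg
      have hI1 : ∫ ω, min (ξ / Λ ω) 1 ≤ 1 := by
        have := norm_integral_le_of_norm_le_const (f := fun ω => min (ξ / Λ ω) 1) (C := 1)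
          (by filter_upwards [hnonneg] with ω hω
              rw [Real.norm_of_nonneg hω]
              exact min_le_right _ _)
        rw [probReal_univ, mul_one] at this
        exact (le_abs_self _).trans this
      have hpR : R - C / (μ - ξ) ≤ R :=
        sub_le_self _ (div_nonneg hC.le (sub_nonneg.2 hξμ.le))
      calc (R - C / (μ - ξ)) * lam * ∫ ω, min (ξ / Λ ω) 1
          ≤ R * lam * ∫ ω, min (ξ / Λ ω) 1 := by gcongr
        _ ≤ R * lam := mul_le_of_le_one_right (by positivity) hI1
    refine le_trans ?_ (le_csSup hbound ⟨μ - s, ⟨by linarith, by linarith⟩, rfl⟩)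
    simp only [sub_sub_cancel, mul_assoc]
    exact mul_le_mul_of_nonneg_left hM hp
  refine csSup_le ((Set.nonempty_Ico.2 hμ).image _) ?_
  rintro _ ⟨ξ, ⟨hξ0, hξμ⟩, rfl⟩
  refine le_trans ?_ hopt
  rcases le_total 0 (R - C / (μ - ξ)) with h | h
  · exact (mul_le_mul_of_nonneg_left (min_le_left _ _) h).trans
      (mm1_revenue_le hR0 hμ hs hsC hξμ)
  · exact (mul_nonpos_of_nonpos_of_nonneg h (le_min hξ0 hlam.le)).trans
      (mul_nonneg hp (sub_nonneg.2 hsμ.le))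
end

section
/- Suppose q₀ ∈ [0, μ/λ_max) satisfies 𝔼[1/(μ − q₀·Λ)] = R/C (the shared-belief equilibrium condition at zero fee). Then q₀ ≤ (μ − C/R)·𝔼[1/Λ]. (The shared-belief equilibrium joining probability at zero fee is at most ξ(0)·𝔼[1/Λ], where ξ(0) = μ − C/R; hence the support of shared-belief effective joining probabilities is contained in that of the private-belief case.) -/
open MeasureTheory

/-- The tangent-line inequality at `v` for the map `u ↦ q * u / (m * u - 1)`, which is convex on
`m * u > 1`. -/
theorem tangent_le_mul_div_sub_one {m q u v : ℝ} (hm : 0 ≤ m) (hq : 0 ≤ q)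
    (hu : 0 < m * u - 1) (hv : 0 < m * v - 1) :
    q * v / (m * v - 1) - q / (m * v - 1) ^ 2 * (u - v) ≤ q * u / (m * u - 1) := by
  have key : q * u / (m * u - 1) - (q * v / (m * v - 1) - q / (m * v - 1) ^ 2 * (u - v))
      = q * m * (u - v) ^ 2 / ((m * u - 1) * (m * v - 1) ^ 2) := by
    have hu' := hu.ne'
    have hv' := hv.ne'
    generalize hd : m * u - 1 = d at hu'
    generalize he : m * v - 1 = e at hv'
    field_simp
    subst hd he
    ring
  have : 0 ≤ q * m * (u - v) ^ 2 / ((m * u - 1) * (m * v - 1) ^ 2) := by positivity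
  linarith

/-- If `q₀ ∈ [0, μ/λ_max)` satisfies the shared-belief equilibrium condition at
zero fee, `𝔼[1/(μ − q₀Λ)] = R/C`, then `q₀ ≤ (μ − C/R)·𝔼[1/Λ] = ξ(0)·𝔼[1/Λ]`. -/
theorem stmt19
    {Ω : Type*} [MeasureSpace Ω] [IsProbabilityMeasure (volume : Measure Ω)]
    (μ R C lamMin lamMax : ℝ)
    (hμ : 0 < μ) (hC : 0 < C) (hR : C / μ ≤ R)
    (hMin : 0 < lamMin) (hMinMax : lamMin ≤ lamMax)
    (Λ : Ω → ℝ) (hΛ : Measurable Λ)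
    (hbdd : ∀ᵐ ω, lamMin ≤ Λ ω ∧ Λ ω ≤ lamMax)
    (q₀ : ℝ) (hq₀ : q₀ ∈ Set.Ico (0 : ℝ) (μ / lamMax))
    (heq : (∫ ω, 1 / (μ - q₀ * Λ ω)) = R / C) :
    q₀ ≤ (μ - C / R) * ∫ ω, 1 / Λ ω := by
  obtain ⟨hq, hqlt⟩ := hq₀
  have hMax : 0 < lamMax := hMin.trans_le hMinMax
  have hqmax : q₀ * lamMax < μ := (lt_div_iff₀ hMax).1 hqlt
  have hRpos : 0 < R := (div_pos hC hμ).trans_le hR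
  have hint : Integrable (fun ω => 1 / Λ ω) := by
    refine Integrable.of_mem_Icc 0 (1 / lamMin) (by fun_prop) ?_
    filter_upwards [hbdd] with ω hω
    have : 0 < Λ ω := hMin.trans_le hω.1
    exact ⟨by positivity, one_div_le_one_div_of_le hMin hω.1⟩
  rcases hq.eq_or_lt with rfl | hqpos
  · have hm : 0 ≤ μ - C / R := by
      rw [sub_nonneg, div_le_iff₀ hRpos]
      rw [div_le_iff₀ hμ] at hR
      linarith
    refine mul_nonneg hm (integral_nonneg_of_ae ?_)
    filter_upwards [hbdd] with ω hω
    have : 0 < Λ ω := hMin.trans_le hω.1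
    simp only [Pi.zero_apply]
    positivity
  have hden : ∀ᵐ ω, 0 < μ - q₀ * lamMax ∧ μ - q₀ * lamMax ≤ μ - q₀ * Λ ω ∧
      μ - q₀ * Λ ω ≤ μ - q₀ * lamMin := by
    filter_upwards [hbdd] with ω hω
    have h1 := mul_le_mul_of_nonneg_left hω.1 hq
    have h2 := mul_le_mul_of_nonneg_left hω.2 hq
    exact ⟨by linarith, by linarith, by linarith⟩
  have hintu : Integrable (fun ω => 1 / (μ - q₀ * Λ ω)) := by
    refine Integrable.of_mem_Icc 0 (1 / (μ - q₀ * lamMax)) (by fun_prop) ?_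
    filter_upwards [hden] with ω ⟨h0, h1, _⟩
    have : 0 < μ - q₀ * Λ ω := h0.trans_le h1
    exact ⟨by positivity, one_div_le_one_div_of_le h0 h1⟩
  have hqmin : 0 < μ - q₀ * lamMin := by
    have := mul_le_mul_of_nonneg_left hMinMax hq
    linarith
  have hmean : 1 / (μ - q₀ * lamMin) ≤ R / C := by
    have h := integral_mono_ae (integrable_const (1 / (μ - q₀ * lamMin))) hintu (by
      filter_upwards [hden] with ω ⟨h0, h1, h2⟩
      exact one_div_le_one_div_of_le (h0.trans_le h1) h2)
    rwa [heq, integral_const, probReal_univ, one_smul] at h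
  have hv : 0 < μ * (R / C) - 1 := by
    have h1 : 1 ≤ R / C * (μ - q₀ * lamMin) := (div_le_iff₀ hqmin).1 hmean
    have h2 : 0 < R / C * (q₀ * lamMin) := by positivity
    linarith
  have htangent : q₀ * (R / C) / (μ * (R / C) - 1) ≤ ∫ ω, 1 / Λ ω := by
    set v := R / C
    have hdev : Integrable (fun ω => q₀ / (μ * v - 1) ^ 2 * (1 / (μ - q₀ * Λ ω) - v)) :=
      (hintu.sub (integrable_const v)).const_mul _
    have h := integral_mono_ae
      (f := fun ω => q₀ * v / (μ * v - 1)
        - q₀ / (μ * v - 1) ^ 2 * (1 / (μ - q₀ * Λ ω) - v))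
      ((integrable_const _).sub hdev) hint (by
        filter_upwards [hbdd, hden] with ω hω ⟨h0, h1, _⟩
        have hΛpos : 0 < Λ ω := hMin.trans_le hω.1
        have hd : 0 < μ - q₀ * Λ ω := h0.trans_le h1
        have hu : μ * (1 / (μ - q₀ * Λ ω)) - 1 = q₀ * Λ ω / (μ - q₀ * Λ ω) := by
          field_simp
          ring
        refine (tangent_le_mul_div_sub_one hμ.le hq (by rw [hu]; positivity) hv).trans_eq ?_
        rw [hu]
        field_simp)
    rw [integral_sub (integrable_const _) hdev,
      integral_const_mul, integral_sub hintu (integrable_const _), heq] at h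
    simpa using h
  have hm : 0 < μ - C / R := by
    have : μ - C / R = C / R * (μ * (R / C) - 1) := by field_simp
    rw [this]
    positivity
  calc q₀ = (μ - C / R) * (q₀ * (R / C) / (μ * (R / C) - 1)) := by
        have hv' := hv.ne'
        have : μ - C / R = C / R * (μ * (R / C) - 1) := by field_simp
        rw [this]
        generalize μ * (R / C) - 1 = D at hv'
        field_simp
    _ ≤ (μ - C / R) * ∫ ω, 1 / Λ ω := mul_le_mul_of_nonneg_left htangent hm.le
end
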